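/- arXiv:0903.0191 — 2 statements merged into one kernel-verified Lean document; each statement's English description precedes it below -/
import Mathlib

section
/- Let X and Y be uniform spaces, let f : X → Y be a uniformly continuous map, and let (ν_β), indexed by a directed set, be a Lévy net of Borel probability measures on X. Then the net of pushforward measures (f∗ν_β) is a Lévy net on Y. -/
open Filter MeasureTheory Topology

/-- A net of Borel (probability) measures on a uniform space, indexed by a directed
preorder, is a *Lévy net* if for every net of Borel sets `A_β` with
`liminf ν_β (A_β) > 0` and every entourage `V`, one has `ν_β (V[A_β]) → 1`,
where `V[A] = {y | ∃ a ∈ A, (a, y) ∈ V}`. -/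
def IsLevyNetUniform {ι X : Type*} [Preorder ι] [UniformSpace X] [MeasurableSpace X]
    (ν : ι → Measure X) : Prop :=
  ∀ A : ι → Set X, (∀ i, MeasurableSet (A i)) →
    0 < liminf (fun i => ν i (A i)) atTop →
    ∀ V ∈ uniformity X,
      Tendsto (fun i => ν i {y | ∃ a ∈ A i, (a, y) ∈ V}) atTop (𝓝 1)

/-- the pushforward of a Lévy net of Borel probability measures under a
uniformly continuous map between uniform spaces is again a Lévy net. -/
theorem stmt5 {ι X Y : Type*} [Preorder ι] [IsDirected ι (· ≤ ·)] [Nonempty ι]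
    [UniformSpace X] [MeasurableSpace X] [BorelSpace X]
    [UniformSpace Y] [MeasurableSpace Y] [BorelSpace Y]
    (f : X → Y) (hf : UniformContinuous f)
    (ν : ι → Measure X) (hν_prob : ∀ i, IsProbabilityMeasure (ν i))
    (hLevy : IsLevyNetUniform ν) :
    IsLevyNetUniform (fun i => Measure.map f (ν i)) := by
  have hfm : Measurable f := hf.continuous.measurable
  intro A hA hpos V hV
  have hpos' : 0 < liminf (fun i => ν i (f ⁻¹' A i)) atTop := by
    simpa only [Measure.map_apply hfm (hA _)] using hpos
  have hlim := hLevy (fun i => f ⁻¹' A i) (fun i => hfm (hA i)) hpos'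
    {p | (f p.1, f p.2) ∈ V} (hf hV)
  refine tendsto_of_tendsto_of_tendsto_of_le_of_le hlim tendsto_const_nhds
    (fun i => ?_) (fun i => ?_)
  · refine (measure_mono ?_).trans (Measure.le_map_apply hfm.aemeasurable _)
    rintro y ⟨a, ha, hay⟩
    exact ⟨f a, ha, hay⟩
  · have := hν_prob i
    have := Measure.isProbabilityMeasure_map (μ := ν i) hfm.aemeasurable
    exact prob_le_one
end

section
/- Let (X,d) be a separable metric space and let ν be a Borel probability measure on X such that every 1-Lipschitz function f : X → ℝ is ν-almost everywhere equal to a constant. Then ν is a Dirac point mass: there exists x ∈ X with ν = δ_x. -/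
open MeasureTheory

/-- if `(X, d)` is a separable metric space and `ν` is a Borel probability
measure on `X` such that every 1-Lipschitz function `f : X → ℝ` is `ν`-a.e. equal to a
constant, then `ν` is a Dirac point mass. -/
theorem stmt16 {X : Type*} [MetricSpace X] [TopologicalSpace.SeparableSpace X]
    [MeasurableSpace X] [BorelSpace X]
    (ν : Measure X) [IsProbabilityMeasure ν]
    (h : ∀ f : X → ℝ, LipschitzWith 1 f → ∃ c : ℝ, ∀ᵐ x ∂ν, f x = c) :
    ∃ x : X, ν = Measure.dirac x := by
  obtain ⟨s, hs_countable, hs_dense⟩ := TopologicalSpace.exists_countable_dense X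
  choose c hc using fun z : X => h (fun x => dist x z) (LipschitzWith.dist_left z)
  have h_ae : ∀ᵐ x ∂ν, ∀ z ∈ s, dist x z = c z :=
    (ae_ball_iff hs_countable).2 fun z _ => hc z
  obtain ⟨x₀, hx₀⟩ := h_ae.exists
  have h_const : id =ᵐ[ν] fun _ => x₀ := by
    filter_upwards [h_ae] with x hx
    have h_dist : (fun z => dist x z) = fun z => dist x₀ z :=
      Continuous.ext_on hs_dense (by fun_prop) (by fun_prop)
        fun z hz => (hx z hz).trans (hx₀ z hz).symm
    exact dist_eq_zero.1 ((congrFun h_dist x₀).trans (dist_self x₀))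
  refine ⟨x₀, ?_⟩
  rw [← Measure.map_id (μ := ν), Measure.map_congr h_const, Measure.map_const,
    measure_univ, one_smul]
end
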